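/- Suppose p > 2, (H1), and let (λ_n, μ_n, u_n) be a sequence of solutions of (q) with μ_n → ∞. Then for any sequence (r_n) ⊂ (0,1) such that u_n(r_n)/μ_n → 0, one has, up to a subsequence: (1) p·∫₀^{r_n} λ_n·u_n^{p−1}·f(u_n)·r dr → ∞; (2) p·μ_n^{p−1}·∫₀^{r_n} λ_n·f(u_n)·r dr → ∞; (3) (log(1/λ_n))/μ_n^p → 0; (4) for every k ∈ ℕ ∪ {0}, (log(1/r_{k,n}))/μ_n^p → δ_k^p/2, where (r_{k,n}) are the concentration-center sequences with u_n(r_{k,n})/μ_n → δ_k and p·λ_n·r_{k,n}²·u_n(r_{k,n})^{p−1}·f(u_n(r_{k,n})) → a_k²/2; and (5) p·μ_n^{p−1}·u_n(r) → ∞ for every r ∈ [0,1). -/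

import Mathlib

open Filter

/-- The bubble sequences `(a_k)`, `(δ_k)` for `p > 2`. -/
def IsBubbleSeq (p : ℝ) (a δ : ℕ → ℝ) : Prop :=
  a 0 = 2 ∧ δ 0 = 1 ∧
  ∀ k : ℕ,
    δ (k + 1) ∈ Set.Ioo 0 (δ k) ∧
    2 * p / (2 + a k) * (1 - δ (k + 1) / δ k) - 1 + (δ (k + 1) / δ k) ^ p = 0 ∧
    a (k + 1) = 2 - (δ (k + 1) / δ k) ^ (p - 1) * (2 + a k) ∧
    a (k + 1) ∈ Set.Ioo (0:ℝ) 2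

open Set Real Topology

/-- `u` solves the radial equation `-(r u')' = lam r f(u)` with `u(0) = μ`, `u(1) = 0`, and
`s(r) = -r u'(r)`. -/
structure RadialProfile (f : ℝ → ℝ) (lam μ : ℝ) (u s : ℝ → ℝ) : Prop where
  lam_pos : 0 < lam
  f_nonneg : ∀ t, 0 ≤ t → 0 ≤ f t
  f_cont : ContinuousOn f (Ici 0)
  u_cont : ContinuousOn u (Icc 0 1)
  s_cont : ContinuousOn s (Icc 0 1)
  u_zero : u 0 = μ
  u_one : u 1 = 0
  s_zero : s 0 = 0
  u_pos : ∀ r ∈ Ico (0:ℝ) 1, 0 < u r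
  u_deriv : ∀ r ∈ Ioo (0:ℝ) 1, HasDerivAt u (-s r / r) r
  s_deriv : ∀ r ∈ Ioo (0:ℝ) 1, HasDerivAt s (lam * r * f (u r)) r

/-- Quantitative form of `log f(x) ~ x ^ p` and `(log f)'(x) ≳ p x ^ (p - 1)` on `[M, ∞)`. -/
structure ExpGrowth (p η M : ℝ) (f : ℝ → ℝ) : Prop where
  one_le : 1 ≤ M
  pos : ∀ x, M ≤ x → 0 < f x
  deriv : ∀ x, M ≤ x → ∃ q, HasDerivAt f (f x * q) x ∧ p * (1 - η) * x ^ (p - 1) ≤ q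
  lower : ∀ x, M ≤ x → exp ((1 - η) * x ^ p) ≤ f x
  upper : ∀ x, M ≤ x → f x ≤ exp ((1 + η) * x ^ p)

theorem monotoneOn_Icc_of_hasDerivAt {g g' : ℝ → ℝ} {a b : ℝ} (hc : ContinuousOn g (Icc a b))
    (hd : ∀ x ∈ Ioo a b, HasDerivAt g (g' x) x) (h0 : ∀ x ∈ Ioo a b, 0 ≤ g' x) :
    MonotoneOn g (Icc a b) := by
  apply monotoneOn_of_hasDerivWithinAt_nonneg (f' := g') (convex_Icc a b) hc
  · intro x hx
    rw [interior_Icc] at hx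
    exact (hd x hx).hasDerivWithinAt
  · intro x hx
    rw [interior_Icc] at hx
    exact h0 x hx

theorem ExpGrowth.monotoneOn {p η M : ℝ} {f : ℝ → ℝ} (g : ExpGrowth p η M f) (hp : 0 < p)
    (hη : η ≤ 1) : MonotoneOn f (Ici M) := by
  choose! q hq1 hq2 using g.deriv
  apply monotoneOn_of_hasDerivWithinAt_nonneg (f' := fun x => f x * q x) (convex_Ici M)
  · intro x hx
    exact (hq1 x hx).continuousAt.continuousWithinAt
  · intro x hx
    exact (hq1 x (interior_subset hx)).hasDerivWithinAt
  · intro x hx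
    have hx' : M ≤ x := interior_subset hx
    have : 0 ≤ x := by linarith [g.one_le]
    have h1 : 0 ≤ p * (1 - η) * x ^ (p - 1) :=
      mul_nonneg (mul_nonneg hp.le (by linarith)) (rpow_nonneg this _)
    exact mul_nonneg (g.pos x hx').le (h1.trans (hq2 x hx'))

namespace RadialProfile

variable {f : ℝ → ℝ} {lam μ : ℝ} {u s : ℝ → ℝ}

theorem u_nonneg (H : RadialProfile f lam μ u s) {r : ℝ} (hr : r ∈ Icc (0:ℝ) 1) : 0 ≤ u r := by
  rcases eq_or_lt_of_le hr.2 with h | h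
  · rw [h, H.u_one]
  · exact (H.u_pos r ⟨hr.1, h⟩).le

theorem s_mono (H : RadialProfile f lam μ u s) : MonotoneOn s (Icc 0 1) :=
  monotoneOn_Icc_of_hasDerivAt H.s_cont H.s_deriv fun _ hr =>
    mul_nonneg (mul_nonneg H.lam_pos.le hr.1.le)
      (H.f_nonneg _ (H.u_nonneg (Ioo_subset_Icc_self hr)))

theorem s_nonneg (H : RadialProfile f lam μ u s) {r : ℝ} (hr : r ∈ Icc (0:ℝ) 1) : 0 ≤ s r := by
  rw [← H.s_zero]
  exact H.s_mono ⟨le_rfl, zero_le_one⟩ hr hr.1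

theorem u_anti (H : RadialProfile f lam μ u s) : AntitoneOn u (Icc 0 1) := by
  have : MonotoneOn (fun r => - u r) (Icc 0 1) :=
    monotoneOn_Icc_of_hasDerivAt H.u_cont.neg (fun r hr => (H.u_deriv r hr).neg) fun _ hr => by
      rw [neg_div, neg_neg]
      exact div_nonneg (H.s_nonneg (Ioo_subset_Icc_self hr)) hr.1.le
  intro x hx y hy hxy
  exact neg_le_neg_iff.1 (this hx hy hxy)

theorem u_le (H : RadialProfile f lam μ u s) {r : ℝ} (hr : r ∈ Icc (0:ℝ) 1) : u r ≤ μ := by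
  rw [← H.u_zero]
  exact H.u_anti ⟨le_rfl, zero_le_one⟩ hr hr.1

theorem μ_pos (H : RadialProfile f lam μ u s) : 0 < μ := by
  rw [← H.u_zero]
  exact H.u_pos 0 ⟨le_rfl, zero_lt_one⟩

theorem fu_cont (H : RadialProfile f lam μ u s) : ContinuousOn (fun r => f (u r)) (Icc 0 1) :=
  H.f_cont.comp H.u_cont fun _ hr => H.u_nonneg hr

theorem exists_level (H : RadialProfile f lam μ u s) {y : ℝ} (h0 : 0 < y) (h1 : y < μ) :
    ∃ r ∈ Ioo (0:ℝ) 1, u r = y := by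
  have := intermediate_value_Ioo' zero_le_one H.u_cont
  rw [H.u_zero, H.u_one] at this
  exact this ⟨h0, h1⟩

theorem lt_of_u_lt (H : RadialProfile f lam μ u s) {x y : ℝ} (hx : x ∈ Icc (0:ℝ) 1)
    (hy : y ∈ Icc (0:ℝ) 1) (h : u y < u x) : x < y := by
  by_contra! hc
  exact absurd (H.u_anti hy hx hc) (not_le.2 h)

/-- In the variable `log r`, the profile is concave. -/
theorem s_mul_log_le (H : RadialProfile f lam μ u s) {a b : ℝ} (ha : 0 < a) (hab : a ≤ b)
    (hb : b ≤ 1) : s a * log (b / a) ≤ u a - u b := by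
  have hm : MonotoneOn (fun r => -(u r) - s a * log r) (Icc a b) := by
    apply monotoneOn_Icc_of_hasDerivAt (g' := fun r => -(-s r / r) - s a * r⁻¹)
    · refine ContinuousOn.sub (H.u_cont.mono (Icc_subset_Icc ha.le hb)).neg
        (continuousOn_const.mul (continuousOn_log.mono ?_))
      intro x hx
      exact (ha.trans_le hx.1).ne'
    · intro x hx
      have hx0 := ha.trans hx.1
      exact (H.u_deriv x ⟨hx0, hx.2.trans_le hb⟩).neg.sub
        ((Real.hasDerivAt_log hx0.ne').const_mul _)
    · intro x hx
      have hx0 := ha.trans hx.1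
      have : s a ≤ s x := H.s_mono ⟨ha.le, hab.trans hb⟩ ⟨hx0.le, hx.2.le.trans hb⟩ hx.1.le
      have : 0 ≤ (s x - s a) * x⁻¹ := mul_nonneg (by linarith) (inv_nonneg.2 hx0.le)
      rw [neg_div, neg_neg, div_eq_mul_inv]
      linarith
  have := hm ⟨le_rfl, hab⟩ ⟨hab, le_rfl⟩ hab
  simp only at this
  rw [log_div (ha.trans_le hab).ne' ha.ne']
  linarith

theorem u_sub_le_s_mul_log (H : RadialProfile f lam μ u s) {a b K : ℝ} (ha : 0 < a)
    (hab : a ≤ b) (hb : b ≤ 1) (hK : ∀ x ∈ Ioo a b, s x ≤ K) :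
    u a - u b ≤ K * log (b / a) := by
  have hm : MonotoneOn (fun r => u r + K * log r) (Icc a b) := by
    apply monotoneOn_Icc_of_hasDerivAt (g' := fun r => -s r / r + K * r⁻¹)
    · refine ContinuousOn.add (H.u_cont.mono (Icc_subset_Icc ha.le hb))
        (continuousOn_const.mul (continuousOn_log.mono ?_))
      intro x hx
      exact (ha.trans_le hx.1).ne'
    · intro x hx
      have hx0 := ha.trans hx.1
      exact (H.u_deriv x ⟨hx0, hx.2.trans_le hb⟩).add
        ((Real.hasDerivAt_log hx0.ne').const_mul _)
    · intro x hx
      have hx0 := ha.trans hx.1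
      have : 0 ≤ (K - s x) * x⁻¹ :=
        mul_nonneg (by linarith [hK x hx]) (inv_nonneg.2 hx0.le)
      rw [div_eq_mul_inv]
      linarith
  have := hm ⟨le_rfl, hab⟩ ⟨hab, le_rfl⟩ hab
  simp only at this
  rw [log_div (ha.trans_le hab).ne' ha.ne']
  linarith

theorem u_sub_le_of_source_le (H : RadialProfile f lam μ u s) {a b τ : ℝ} (ha : 0 < a)
    (hab : a ≤ b) (hb : b ≤ 1) (hτ0 : 0 ≤ τ)
    (hτ : ∀ x ∈ Ioc a b, lam * x ^ 2 * f (u x) ≤ τ) :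
    u a - u b ≤ (s a + τ * log (b / a)) * log (b / a) := by
  apply H.u_sub_le_s_mul_log ha hab hb
  intro y hy
  have hm : MonotoneOn (fun r => τ * log r - s r) (Icc a b) := by
    apply monotoneOn_Icc_of_hasDerivAt (g' := fun r => τ * r⁻¹ - lam * r * f (u r))
    · refine ContinuousOn.sub (continuousOn_const.mul (continuousOn_log.mono ?_))
        (H.s_cont.mono (Icc_subset_Icc ha.le hb))
      intro x hx
      exact (ha.trans_le hx.1).ne'
    · intro x hx
      have hx0 := ha.trans hx.1
      exact ((Real.hasDerivAt_log hx0.ne').const_mul _).sub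
        (H.s_deriv x ⟨hx0, hx.2.trans_le hb⟩)
    · intro x hx
      have hx0 := ha.trans hx.1
      have : 0 ≤ (τ - lam * x ^ 2 * f (u x)) * x⁻¹ :=
        mul_nonneg (by linarith [hτ x ⟨hx.1, hx.2.le⟩]) (inv_nonneg.2 hx0.le)
      have e : lam * x ^ 2 * f (u x) * x⁻¹ = lam * x * f (u x) := by field_simp
      rw [sub_mul, e] at this
      exact this
  have h1 := hm ⟨le_rfl, hab⟩ ⟨hy.1.le, hy.2.le⟩ hy.1.le
  simp only at h1
  have h2 : τ * log y ≤ τ * log b :=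
    mul_le_mul_of_nonneg_left (log_le_log (ha.trans hy.1) hy.2.le) hτ0
  rw [log_div (ha.trans_le hab).ne' ha.ne', mul_sub]
  linarith

/-- A Pohozaev type inequality. -/
theorem source_le {p η M : ℝ} (H : RadialProfile f lam μ u s) (g : ExpGrowth p η M f)
    (hp : 1 ≤ p) (hη : η ≤ 1) {R : ℝ} (hR : R ∈ Ioo (0:ℝ) 1) (hM : M ≤ u R) :
    lam * R ^ 2 * f (u R) ≤ 2 * s R - p * (1 - η) * u R ^ (p - 1) * s R ^ 2 / 2 := by
  choose! q hq1 hq2 using g.deriv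
  set Q := p * (1 - η) * u R ^ (p - 1) with hQ
  have hsub : Icc 0 R ⊆ Icc (0:ℝ) 1 := Icc_subset_Icc le_rfl hR.2.le
  have hm : MonotoneOn (fun r => 2 * s r - Q * s r ^ 2 / 2 - lam * r ^ 2 * f (u r))
      (Icc 0 R) := by
    apply monotoneOn_Icc_of_hasDerivAt (g' := fun r => 2 * (lam * r * f (u r))
      - Q * (2 * s r * (lam * r * f (u r))) / 2
      - (lam * (2 * r) * f (u r) + lam * r ^ 2 * (f (u r) * q (u r) * (-s r / r))))
    · have h1 := H.s_cont.mono hsub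
      have h2 := H.fu_cont.mono hsub
      have h3 : ContinuousOn (fun r : ℝ => lam * r ^ 2) (Icc 0 R) := by fun_prop
      exact ((continuousOn_const.mul h1).sub
        ((continuousOn_const.mul (h1.pow 2)).div_const 2)).sub (h3.mul h2)
    · intro x hx
      have hx1 : x ∈ Ioo (0:ℝ) 1 := ⟨hx.1, hx.2.trans hR.2⟩
      have hux : M ≤ u x :=
        hM.trans (H.u_anti (Ioo_subset_Icc_self hx1) (Ioo_subset_Icc_self hR) hx.2.le)
      have d1 := H.s_deriv x hx1
      have d2 := (hq1 _ hux).comp x (H.u_deriv x hx1)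
      have d3 := ((hasDerivAt_pow 2 x).const_mul lam).mul d2
      have d4 := (d1.pow 2).const_mul Q
      refine (((d1.const_mul 2).sub (d4.div_const 2)).sub d3).congr_deriv ?_
      simp
    · intro x hx
      have hx1 : x ∈ Ioo (0:ℝ) 1 := ⟨hx.1, hx.2.trans hR.2⟩
      have hxx := Ioo_subset_Icc_self hx1
      have huxR := H.u_anti hxx (Ioo_subset_Icc_self hR) hx.2.le
      have hux : M ≤ u x := hM.trans huxR
      have hq : Q ≤ q (u x) := by
        refine le_trans ?_ (hq2 _ hux)
        have : 0 ≤ u R := H.u_nonneg (Ioo_subset_Icc_self hR)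
        exact mul_le_mul_of_nonneg_left (rpow_le_rpow this huxR (by linarith))
          (mul_nonneg (by linarith) (by linarith))
      have e : 2 * (lam * x * f (u x)) - Q * (2 * s x * (lam * x * f (u x))) / 2
          - (lam * (2 * x) * f (u x) + lam * x ^ 2 * (f (u x) * q (u x) * (-s x / x)))
          = lam * x * f (u x) * s x * (q (u x) - Q) := by
        have := hx.1.ne'
        field_simp
        ring
      rw [e]
      have := H.lam_pos
      have := hx.1
      have := g.pos _ hux
      have := H.s_nonneg hxx
      have : 0 ≤ q (u x) - Q := by linarith
      positivity
  have := hm ⟨le_rfl, hR.1.le⟩ ⟨hR.1.le, le_rfl⟩ hR.1.le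
  simp only [H.s_zero] at this
  linarith

theorem s_le {p η M : ℝ} (H : RadialProfile f lam μ u s) (g : ExpGrowth p η M f)
    (hp : 1 ≤ p) (hη : η < 1) {R : ℝ} (hR : R ∈ Ioo (0:ℝ) 1) (hM : M ≤ u R) :
    p * (1 - η) * u R ^ (p - 1) * s R ≤ 4 := by
  have h1 := H.source_le g hp hη.le hR hM
  have h2 : 0 ≤ lam * R ^ 2 * f (u R) := by
    have := H.lam_pos
    have := g.pos _ hM
    positivity
  by_contra! hc
  have hs : 0 < s R := by
    rcases (H.s_nonneg (Ioo_subset_Icc_self hR)).eq_or_lt with h | h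
    · rw [← h] at hc
      norm_num at hc
    · exact h
  nlinarith

theorem source_le_eight {p η M : ℝ} (H : RadialProfile f lam μ u s) (g : ExpGrowth p η M f)
    (hp : 2 ≤ p) (hη : η ≤ 1 / 2) {R : ℝ} (hR : R ∈ Ioo (0:ℝ) 1) (hM : M ≤ u R) :
    lam * R ^ 2 * f (u R) ≤ 8 := by
  have h1 := H.source_le g (by linarith) (by linarith) hR hM
  have h2 := H.s_le g (by linarith) (by linarith) hR hM
  have hs := H.s_nonneg (Ioo_subset_Icc_self hR)
  have hu : 1 ≤ u R ^ (p - 1) := one_le_rpow (g.one_le.trans hM) (by linarith)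
  have h3 : 1 ≤ p * (1 - η) * u R ^ (p - 1) := by
    have : 1 ≤ p * (1 - η) := by nlinarith
    nlinarith
  have h4 : s R ≤ 4 := by nlinarith
  nlinarith [sq_nonneg (s R)]

theorem drop_le {p η M : ℝ} (H : RadialProfile f lam μ u s) (g : ExpGrowth p η M f)
    (hp : 0 < p) (hη : η ≤ 1) {R : ℝ} (hR : R ∈ Ioo (0:ℝ) 1) (hM : M ≤ u R) :
    μ - u R ≤ lam * f μ * R ^ 2 / 4 := by
  have hsub : Icc 0 R ⊆ Icc (0:ℝ) 1 := Icc_subset_Icc le_rfl hR.2.le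
  have hs : MonotoneOn (fun r => lam * f μ * r ^ 2 / 2 - s r) (Icc 0 R) := by
    apply monotoneOn_Icc_of_hasDerivAt
      (g' := fun r => lam * f μ * (2 * r) / 2 - lam * r * f (u r))
    · exact ContinuousOn.sub (by fun_prop) (H.s_cont.mono hsub)
    · intro x hx
      refine ((((hasDerivAt_pow 2 x).const_mul (lam * f μ)).div_const 2).sub
        (H.s_deriv x ⟨hx.1, hx.2.trans hR.2⟩)).congr_deriv ?_
      simp
    · intro x hx
      have hx1 : x ∈ Icc (0:ℝ) 1 := ⟨hx.1.le, (hx.2.trans hR.2).le⟩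
      have hux : M ≤ u x := hM.trans (H.u_anti hx1 (Ioo_subset_Icc_self hR) hx.2.le)
      have : f (u x) ≤ f μ :=
        g.monotoneOn hp hη hux (hux.trans (H.u_le hx1)) (H.u_le hx1)
      have : 0 ≤ lam * x * (f μ - f (u x)) :=
        mul_nonneg (mul_nonneg H.lam_pos.le hx.1.le) (by linarith)
      linarith
  have hm : MonotoneOn (fun r => u r + lam * f μ * r ^ 2 / 4) (Icc 0 R) := by
    apply monotoneOn_Icc_of_hasDerivAt
      (g' := fun r => -s r / r + lam * f μ * (2 * r) / 4)
    · exact ContinuousOn.add (H.u_cont.mono hsub) (by fun_prop)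
    · intro x hx
      refine ((H.u_deriv x ⟨hx.1, hx.2.trans hR.2⟩).add
        (((hasDerivAt_pow 2 x).const_mul (lam * f μ)).div_const 4)).congr_deriv ?_
      simp
    · intro x hx
      have h1 := hs ⟨le_rfl, hR.1.le⟩ ⟨hx.1.le, hx.2.le⟩ hx.1.le
      simp only [H.s_zero] at h1
      have h2 : 0 ≤ (lam * f μ * x ^ 2 / 2 - s x) / x :=
        div_nonneg (by linarith) hx.1.le
      have e : (lam * f μ * x ^ 2 / 2 - s x) / x = -s x / x + lam * f μ * (2 * x) / 4 := by
        have := hx.1.ne'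
        field_simp
        ring
      rwa [e] at h2
  have := hm ⟨le_rfl, hR.1.le⟩ ⟨hR.1.le, le_rfl⟩ hR.1.le
  simp only [H.u_zero] at this
  linarith

theorem exists_first_bubble {p η M : ℝ} (H : RadialProfile f lam μ u s)
    (g : ExpGrowth p η M f) (hp : 2 ≤ p) (hη0 : 0 < η) (hη : η ≤ 1 / 2)
    (hM : M ≤ μ / 2) (hμ : 1 ≤ 4 * (η / p * μ)) :
    ∃ r ∈ Ioo (0:ℝ) 1, μ / 2 < u r ∧ exp (-(3 * η * μ ^ p)) ≤ lam * r ^ 2 * f (u r) := by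
  have hμ0 := H.μ_pos
  have hθ0 : 0 < η / p := by positivity
  have hθ : η / p ≤ 1 / 4 := by
    rw [div_le_iff₀ (by linarith)]
    linarith
  obtain ⟨r, hr, hur⟩ := H.exists_level (y := (1 - η / p) * μ) (by nlinarith) (by nlinarith)
  have hgt : μ / 2 < u r := by
    rw [hur]
    nlinarith
  refine ⟨r, hr, hgt, ?_⟩
  have hMr : M ≤ u r := by linarith
  have h1 := H.drop_le g (by linarith) (by linarith) hr hMr
  have h2 : 1 ≤ lam * r ^ 2 * f μ := by
    rw [hur] at h1
    nlinarith
  have hlr : 0 < lam * r ^ 2 := by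
    have := H.lam_pos
    have := hr.1
    positivity
  have h3 : exp (-((1 + η) * μ ^ p)) ≤ lam * r ^ 2 := by
    rw [exp_neg, inv_le_iff_one_le_mul₀ (exp_pos _)]
    exact h2.trans (mul_le_mul_of_nonneg_left (g.upper μ (by linarith)) hlr.le)
  have h4 : exp ((1 - η) * ((1 - η) * μ ^ p)) ≤ f (u r) := by
    refine le_trans (exp_le_exp.2 ?_) (g.lower _ hMr)
    apply mul_le_mul_of_nonneg_left _ (by linarith)
    rw [hur, mul_rpow (by linarith) hμ0.le]
    apply mul_le_mul_of_nonneg_right _ (by positivity)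
    have := one_add_mul_self_le_rpow_one_add (s := -(η / p)) (by linarith) (p := p) (by linarith)
    have e : p * -(η / p) = -η := by field_simp
    rw [e] at this
    exact this
  calc exp (-(3 * η * μ ^ p))
      ≤ exp (-((1 + η) * μ ^ p)) * exp ((1 - η) * ((1 - η) * μ ^ p)) := by
        rw [← exp_add, exp_le_exp]
        have : 0 ≤ η ^ 2 * μ ^ p := by positivity
        linarith
    _ ≤ _ := mul_le_mul h3 h4 (exp_pos _).le hlr.le

theorem exists_last_bubble {p η M : ℝ} (H : RadialProfile f lam μ u s)
    (g : ExpGrowth p η M f) (hp : 2 ≤ p) (hη0 : 0 < η) (hη : η ≤ 1 / 2)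
    (hM : M ≤ μ / 2) (hμ : 1 ≤ 4 * (η / p * μ)) {R : ℝ} (hR : R ∈ Ioc (0:ℝ) 1)
    (huR : u R ≤ μ / 2) :
    ∃ b, 0 < b ∧ b ≤ R ∧ exp (-(3 * η * μ ^ p)) ≤ lam * b ^ 2 * f (u b) ∧
      ∀ x ∈ Ioc b R, lam * x ^ 2 * f (u x) ≤ exp (-(3 * η * μ ^ p)) := by
  obtain ⟨r, hr, hur, hW⟩ := H.exists_first_bubble g hp hη0 hη hM hμ
  have hrR : r < R := H.lt_of_u_lt (Ioo_subset_Icc_self hr) (Ioc_subset_Icc_self hR)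
    (huR.trans_lt hur)
  have hsub : Icc r R ⊆ Icc (0:ℝ) 1 := Icc_subset_Icc hr.1.le hR.2
  have hc : ContinuousOn (fun x => lam * x ^ 2 * f (u x)) (Icc r R) :=
    ContinuousOn.mul (by fun_prop) (H.fu_cont.mono hsub)
  have hcl : IsClosed (Icc r R ∩ (fun x => lam * x ^ 2 * f (u x)) ⁻¹'
      Ici (exp (-(3 * η * μ ^ p)))) := hc.preimage_isClosed_of_isClosed isClosed_Icc isClosed_Ici
  have hcomp := isCompact_Icc.of_isClosed_subset hcl inter_subset_left
  obtain ⟨b, hb, hbmax⟩ := hcomp.exists_isGreatest ⟨r, ⟨le_rfl, hrR.le⟩, hW⟩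
  refine ⟨b, hr.1.trans_le hb.1.1, hb.1.2, hb.2, fun x hx => ?_⟩
  by_contra! hc
  exact absurd (hbmax ⟨⟨hb.1.1.trans hx.1.le, hx.2⟩, hc.le⟩) (not_le.2 hx.1)

theorem two_mul_log_le {p η M : ℝ} (H : RadialProfile f lam μ u s)
    (g : ExpGrowth p η M f) (hp : 2 ≤ p) (hη0 : 0 < η) {b R : ℝ} (hb : 0 < b) (hbR : b ≤ R)
    (hR : R ≤ 1) (hlR : lam * R ^ 2 ≤ exp (η * μ ^ p))
    (hW : exp (-(3 * η * μ ^ p)) ≤ lam * b ^ 2 * f (u b)) (hM : M ≤ u b) :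
    2 * log (R / b) ≤ u b ^ p + 5 * η * μ ^ p := by
  have hlam := H.lam_pos
  have hub : u b ≤ μ := H.u_le ⟨hb.le, hbR.trans hR⟩
  have hu0 : 0 ≤ u b := by linarith [g.one_le]
  have hR0 := hb.trans_le hbR
  have h1 := log_le_log (by positivity) hlR
  have h2 := log_le_log (exp_pos _) hW
  have h3 := log_le_log (g.pos _ hM) (g.upper _ hM)
  have hfpos := g.pos _ hM
  rw [log_exp] at h1 h3
  rw [log_exp, log_mul (by positivity) hfpos.ne'] at h2
  rw [log_mul hlam.ne' (by positivity), log_pow] at h1 h2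
  rw [log_div hR0.ne' hb.ne']
  push_cast at h1 h2
  have h4 : η * u b ^ p ≤ η * μ ^ p :=
    mul_le_mul_of_nonneg_left (rpow_le_rpow hu0 hub (by linarith)) hη0.le
  linarith

/-- After the last concentration, the profile is almost linear in `log r` and, since `p > 2`,
it can lose only a fixed proportion of its height. -/
theorem proportion_le {p η M ε : ℝ} (H : RadialProfile f lam μ u s)
    (g : ExpGrowth p η M f) (hp : 2 ≤ p) (hη0 : 0 < η) (hη : η ≤ 1 / 2) (hε : 0 < ε)
    (hηε : 2 * (1 + 5 * η / ε ^ p) / (p * (1 - η)) + η ≤ (1 + 2 / p) / 2)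
    (hμ : 4 * (μ ^ p) ^ 2 * exp (-(3 * η * μ ^ p)) ≤ η)
    {b R : ℝ} (hb : 0 < b) (hbR : b ≤ R)
    (hR : R ≤ 1) (hlR : lam * R ^ 2 ≤ exp (η * μ ^ p))
    (hW : exp (-(3 * η * μ ^ p)) ≤ lam * b ^ 2 * f (u b)) (hM : M ≤ u b)
    (hεb : ε * μ ≤ u b)
    (hlast : ∀ x ∈ Ioc b R, lam * x ^ 2 * f (u x) ≤ exp (-(3 * η * μ ^ p))) :
    (1 - 2 / p) / 2 * u b ≤ u R := by
  have hT := H.two_mul_log_le g hp hη0 hb hbR hR hlR hW hM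
  have hdrop := H.u_sub_le_of_source_le hb hbR hR (exp_pos _).le hlast
  have hu1 : 1 ≤ u b := g.one_le.trans hM
  have hb1 : b < 1 := by
    refine lt_of_le_of_ne (hbR.trans hR) fun h => ?_
    rw [h, H.u_one] at hu1
    linarith
  have hs := H.s_le g (by linarith) (by linarith) ⟨hb, hb1⟩ hM
  have hs0 := H.s_nonneg ⟨hb.le, hb1.le⟩
  have hub : u b ≤ μ := H.u_le ⟨hb.le, hb1.le⟩
  have hμ0 := H.μ_pos
  set T := log (R / b) with hTdef
  have hT0 : 0 ≤ T := log_nonneg ((one_le_div hb).2 hbR)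
  set m := μ ^ p with hm
  have hm0 : 0 < m := by positivity
  have hum : u b ^ p ≤ m := rpow_le_rpow (by linarith) hub (by linarith)
  have hT2 : T ≤ 2 * m := by nlinarith
  have hτ : exp (-(3 * η * m)) * T ^ 2 ≤ η := by
    have : T ^ 2 ≤ 4 * m ^ 2 := by nlinarith
    nlinarith [exp_pos (-(3 * η * m))]
  have hA : u b ^ p = u b ^ (p - 1) * u b := by
    rw [← rpow_add_one (by linarith)]
    congr 1
    ring
  set A := u b ^ (p - 1) with hAdef
  have hA0 : 0 < A := rpow_pos_of_pos (by linarith) _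
  have hεp : 0 < ε ^ p := by positivity
  have hme : m ≤ A * u b / ε ^ p := by
    rw [le_div_iff₀ hεp, ← hA, hm, mul_comm, ← mul_rpow hε.le hμ0.le]
    exact rpow_le_rpow (by positivity) hεb (by linarith)
  have hP : 0 < p * (1 - η) := mul_pos (by linarith) (by linarith)
  have hsT : s b * T ≤ 2 * (1 + 5 * η / ε ^ p) / (p * (1 - η)) * u b := by
    have hT3 : 2 * T ≤ A * u b * (1 + 5 * η / ε ^ p) := by
      have : 5 * η * m ≤ 5 * η * (A * u b / ε ^ p) :=
        mul_le_mul_of_nonneg_left hme (by positivity)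
      have e : A * u b * (1 + 5 * η / ε ^ p) = A * u b + 5 * η * (A * u b / ε ^ p) := by ring
      linarith
    have h1 : s b ≤ 4 / (p * (1 - η) * A) := by
      rw [le_div_iff₀ (by positivity)]
      linarith
    calc s b * T ≤ 4 / (p * (1 - η) * A) * (A * u b * (1 + 5 * η / ε ^ p) / 2) :=
          mul_le_mul h1 (by linarith) hT0 (by positivity)
      _ = _ := by
        field_simp
        ring
  have hfin : u b - u R ≤ (2 * (1 + 5 * η / ε ^ p) / (p * (1 - η)) + η) * u b := by
    have : (s b + exp (-(3 * η * m)) * T) * T = s b * T + exp (-(3 * η * m)) * T ^ 2 := by ring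
    have : η ≤ η * u b := le_mul_of_one_le_right hη0.le hu1
    linarith
  have := mul_le_mul_of_nonneg_right hηε (by linarith : 0 ≤ u b)
  linarith

end RadialProfile

section Quantitative

variable {p : ℝ} {f : ℝ → ℝ}

theorem exists_pos_lt_of_continuousAt {F : ℝ → ℝ} (hc : ContinuousAt F 0) {c e : ℝ}
    (hlt : F 0 < c) (he : 0 < e) : ∃ x, 0 < x ∧ x < e ∧ F x < c := by
  have h1 : ∀ᶠ x in 𝓝[>] 0, F x < c := (hc.eventually_lt_const hlt).filter_mono nhdsWithin_le_nhds
  have h2 : ∀ᶠ x : ℝ in 𝓝[>] 0, x < e := (eventually_lt_nhds he).filter_mono nhdsWithin_le_nhds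
  obtain ⟨x, h1, h2, h3⟩ := (h1.and (h2.and self_mem_nhdsWithin)).exists
  exact ⟨x, h3, h2, h1⟩

theorem exists_small_parameter (hp : 2 < p) (ε : ℝ) {e : ℝ} (he : 0 < e) :
    ∃ η, 0 < η ∧ η ≤ 1 / 2 ∧ η ≤ e ∧
      2 * (1 + 5 * η / ε ^ p) / (p * (1 - η)) + η ≤ (1 + 2 / p) / 2 := by
  have hc : ContinuousAt (fun η : ℝ => 2 * (1 + 5 * η / ε ^ p) / (p * (1 - η)) + η) 0 := by
    have : p * (1 - 0) ≠ 0 := by linarith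
    fun_prop (disch := assumption)
  have hlt : (fun η : ℝ => 2 * (1 + 5 * η / ε ^ p) / (p * (1 - η)) + η) 0 < (1 + 2 / p) / 2 := by
    have : 2 / p < 1 := by rwa [div_lt_one (by linarith)]
    norm_num
    linarith
  obtain ⟨η, h3, h2, h1⟩ := exists_pos_lt_of_continuousAt hc hlt (e := min (1 / 2) e) (by positivity)
  exact ⟨η, h3, h2.le.trans (min_le_left _ _), h2.le.trans (min_le_right _ _), h1.le⟩

theorem tendsto_rpow_mul_atTop {η : ℝ} (hp : 0 < p) (hη : 0 < η) :
    Tendsto (fun μ : ℝ => η * μ ^ p) atTop atTop :=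
  (tendsto_rpow_atTop hp).const_mul_atTop hη

theorem eventually_exp_small {η : ℝ} (hp : 0 < p) (hη : 0 < η) :
    ∀ᶠ μ : ℝ in atTop, 4 * (μ ^ p) ^ 2 * exp (-(3 * η * μ ^ p)) ≤ η := by
  have h1 := (tendsto_pow_mul_exp_neg_atTop_nhds_zero 2).comp
    (tendsto_rpow_mul_atTop (η := 3 * η) hp (by positivity))
  have h2 : 0 < η * (9 * η ^ 2 / 4) := by positivity
  filter_upwards [h1.eventually_le_const h2] with μ hμ
  simp only [Function.comp] at hμ
  have : (9 * η ^ 2 / 4) * (4 * (μ ^ p) ^ 2 * exp (-(3 * η * μ ^ p))) ≤ (9 * η ^ 2 / 4) * η := by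
    calc _ = (3 * η * μ ^ p) ^ 2 * exp (-(3 * η * μ ^ p)) := by ring
      _ ≤ _ := hμ
      _ = _ := by ring
  exact le_of_mul_le_mul_left this (by positivity)

theorem RadialProfile.lam_mul_sq_le {η M lam μ : ℝ} {u s : ℝ → ℝ}
    (H : RadialProfile f lam μ u s) (g : ExpGrowth p η M f)
    (hp : 2 ≤ p) (hη : η ≤ 1 / 2) (h8 : 8 ≤ exp (η * μ ^ p))
    {R : ℝ} (hR : R ∈ Ioo (0:ℝ) 1) (hM : M ≤ u R) : lam * R ^ 2 ≤ exp (η * μ ^ p) := by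
  have h1 := H.source_le_eight g hp hη hR hM
  have hu : 0 ≤ u R := H.u_nonneg (Ioo_subset_Icc_self hR)
  have h2 : 1 ≤ f (u R) := by
    refine le_trans (one_le_exp ?_) (g.lower _ hM)
    exact mul_nonneg (by linarith) (rpow_nonneg hu _)
  have h3 : 0 ≤ lam * R ^ 2 := mul_nonneg H.lam_pos.le (sq_nonneg _)
  nlinarith

theorem exists_le_rpow_mul_s (hp : 2 < p) (hg : ∀ η, 0 < η → ∃ M, ExpGrowth p η M f) :
    ∃ c, 0 < c ∧ ∀ ε, 0 < ε → ∀ᶠ μ : ℝ in atTop, ∀ (lam : ℝ) (u s : ℝ → ℝ),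
      RadialProfile f lam μ u s → ∀ r ∈ Ioo (0:ℝ) 1, ε * μ ≤ u r → u r ≤ μ / 4 →
        c ≤ u r ^ (p - 1) * s r := by
  have hp0 : 0 < p := by linarith
  set κ := (1 - 2 / p) / 2 with hκ
  have hκ0 : 0 < κ := by
    have : 2 / p < 1 := by rwa [div_lt_one (by linarith)]
    rw [hκ]
    linarith
  have hB : 0 < (2 / κ) ^ p + 1 := by positivity
  refine ⟨2 / ((2 / κ) ^ p + 1), by positivity, fun ε hε => ?_⟩
  have hεp : 0 < ε ^ p := by positivity
  obtain ⟨η, hη0, hη, hη5, hηε⟩ := exists_small_parameter hp ε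
    (e := ε ^ p / 5) (by positivity)
  obtain ⟨M, g⟩ := hg η hη0
  have t1 : ∀ᶠ μ : ℝ in atTop, M ≤ ε * μ :=
    (tendsto_id.const_mul_atTop hε).eventually_ge_atTop M
  have t2 : ∀ᶠ μ : ℝ in atTop, 1 ≤ 4 * (η / p * μ) :=
    ((tendsto_id.const_mul_atTop (by positivity)).const_mul_atTop (by norm_num)
      ).eventually_ge_atTop 1
  have t3 := (tendsto_rpow_mul_atTop hp0 hη0).eventually_ge_atTop (log 8)
  filter_upwards [t1, t2, t3, eventually_exp_small hp0 hη0, eventually_ge_atTop (2 * M)]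
    with μ h1 h2 h3 h4 h5 lam u s H r hr hru hru4
  have h8 : 8 ≤ exp (η * μ ^ p) := (log_le_iff_le_exp (by norm_num)).1 h3
  have hμ0 := H.μ_pos
  have hM1 := g.one_le
  have hur : 0 < u r := by linarith
  obtain ⟨r₁, hr₁, hur₁⟩ := H.exists_level (y := 2 * u r) (by linarith) (by linarith)
  have hr1r : r₁ < r := H.lt_of_u_lt (Ioo_subset_Icc_self hr₁) (Ioo_subset_Icc_self hr)
    (by linarith)
  obtain ⟨b, hb0, hbr, hWb, hlast⟩ := H.exists_last_bubble g hp.le hη0 hη (by linarith) h2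
    (Ioo_subset_Ioc_self hr₁) (by linarith)
  have hub : u r₁ ≤ u b := H.u_anti ⟨hb0.le, hbr.trans hr₁.2.le⟩ (Ioo_subset_Icc_self hr₁) hbr
  have hκb := H.proportion_le g hp.le hη0 hη hε hηε h4 hb0 hbr hr₁.2.le
    (H.lam_mul_sq_le g hp.le hη h8 hr₁ (by linarith)) hWb (by linarith) (by linarith) hlast
  have hT := H.two_mul_log_le g hp.le hη0 hb0 (hbr.trans hr1r.le) hr.2.le
    (H.lam_mul_sq_le g hp.le hη h8 hr (by linarith)) hWb (by linarith)
  have hd := H.u_sub_le_s_mul_log hr₁.1 hr1r.le hr.2.le (K := s r) fun x hx =>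
    H.s_mono ⟨(hr₁.1.trans hx.1).le, (hx.2.trans hr.2).le⟩ (Ioo_subset_Icc_self hr) hx.2.le
  have hlog : log (r / r₁) ≤ log (r / b) :=
    log_le_log (div_pos hr.1 hr₁.1) (div_le_div_of_nonneg_left hr.1.le hb0 hbr)
  have hubp : u b ^ p ≤ (2 / κ) ^ p * u r ^ p := by
    rw [← mul_rpow (by positivity) hur.le]
    refine rpow_le_rpow (by linarith) ?_ hp0.le
    rw [div_mul_eq_mul_div, le_div_iff₀ hκ0, ← hur₁, mul_comm]
    exact hκb
  have hη5' : 5 * η * μ ^ p ≤ u r ^ p := by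
    calc 5 * η * μ ^ p ≤ ε ^ p * μ ^ p :=
          mul_le_mul_of_nonneg_right (by linarith) (by positivity)
      _ = (ε * μ) ^ p := (mul_rpow hε.le hμ0.le).symm
      _ ≤ _ := rpow_le_rpow (by positivity) hru hp0.le
  have hs := H.s_nonneg (Ioo_subset_Icc_self hr)
  have hA : u r ^ p = u r ^ (p - 1) * u r := by
    rw [← rpow_add_one hur.ne']
    congr 1
    ring
  have hTb : log (r / r₁) ≤ ((2 / κ) ^ p + 1) * u r ^ p / 2 := by linarith
  have := mul_le_mul_of_nonneg_left hTb hs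
  rw [div_le_iff₀ hB]
  rw [hA] at this
  have h9 : 2 * u r ≤ (u r ^ (p - 1) * s r * ((2 / κ) ^ p + 1)) * u r := by
    calc 2 * u r ≤ 2 * (s r * (((2 / κ) ^ p + 1) * (u r ^ (p - 1) * u r) / 2)) := by linarith
      _ = _ := by ring
  exact le_of_mul_le_mul_right h9 hur

theorem exists_le_mul_s (hp : 2 < p) (hg : ∀ η, 0 < η → ∃ M, ExpGrowth p η M f) (K : ℝ) :
    ∃ ε, 0 < ε ∧ ∀ᶠ μ : ℝ in atTop, ∀ (lam : ℝ) (u s : ℝ → ℝ),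
      RadialProfile f lam μ u s → ∀ r ∈ Ioo (0:ℝ) 1, u r < ε * μ → K ≤ μ ^ (p - 1) * s r := by
  obtain ⟨c, hc, hcε⟩ := exists_le_rpow_mul_s hp hg
  have hcont : ContinuousAt (fun ε : ℝ => K * ε ^ (p - 1)) 0 :=
    continuousAt_const.mul (continuousAt_rpow_const _ _ (Or.inr (by linarith)))
  have hlt : (fun ε : ℝ => K * ε ^ (p - 1)) 0 < c := by
    simpa [zero_rpow (by linarith : p - 1 ≠ 0)] using hc
  obtain ⟨ε, h3, h2, h1⟩ := exists_pos_lt_of_continuousAt hcont hlt (e := 1 / 4) (by norm_num)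
  refine ⟨ε, h3, ?_⟩
  filter_upwards [hcε ε h3] with μ hμ lam u s H r hr hur
  have hμ0 := H.μ_pos
  obtain ⟨r₁, hr₁, hur₁⟩ := H.exists_level (y := ε * μ) (by positivity) (by nlinarith)
  have hr1r : r₁ < r := H.lt_of_u_lt (Ioo_subset_Icc_self hr₁) (Ioo_subset_Icc_self hr)
    (by linarith)
  have h5 := hμ lam u s H r₁ hr₁ hur₁.ge (by rw [hur₁]; nlinarith)
  have h6 := H.s_mono (Ioo_subset_Icc_self hr₁) (Ioo_subset_Icc_self hr) hr1r.le
  rw [hur₁, mul_rpow h3.le hμ0.le] at h5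
  have hεp : 0 < ε ^ (p - 1) := by positivity
  have h7 : K * ε ^ (p - 1) ≤ (μ ^ (p - 1) * s r₁) * ε ^ (p - 1) := by linarith
  exact (le_of_mul_le_mul_right h7 hεp).trans
    (mul_le_mul_of_nonneg_left h6 (rpow_nonneg hμ0.le _))

theorem exists_le_energy (hp : 2 < p) (hg : ∀ η, 0 < η → ∃ M, ExpGrowth p η M f) (K : ℝ) :
    ∃ ε, 0 < ε ∧ ∀ᶠ μ : ℝ in atTop, ∀ (lam : ℝ) (u s : ℝ → ℝ),
      RadialProfile f lam μ u s → ∀ r ∈ Ioo (0:ℝ) 1, u r < ε * μ →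
        K ≤ ∫ x in (0:ℝ)..r, lam * u x ^ (p - 1) * f (u x) * x := by
  obtain ⟨c, hc, hcε⟩ := exists_le_rpow_mul_s hp hg
  have hpc : 0 < (p - 1) * c := mul_pos (by linarith) hc
  set L := |K| / ((p - 1) * c) + 1 with hL
  have hL0 : 0 < L := by positivity
  have hexp : exp (-L) < 1 := by rw [exp_lt_one_iff]; linarith
  have hε : 0 < exp (-L) / 4 := by positivity
  refine ⟨exp (-L) / 4, hε, ?_⟩
  filter_upwards [hcε _ hε] with μ hμ lam u s H r hr hur
  have hμ0 := H.μ_pos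
  have hlev : exp (-L) / 4 * μ < μ / 4 := by nlinarith
  obtain ⟨r₁, hr₁, hur₁⟩ := H.exists_level (y := μ / 4) (by positivity) (by linarith)
  obtain ⟨r₂, hr₂, hur₂⟩ := H.exists_level (y := exp (-L) / 4 * μ) (by positivity) (by linarith)
  have hr12 : r₁ < r₂ := H.lt_of_u_lt (Ioo_subset_Icc_self hr₁) (Ioo_subset_Icc_self hr₂)
    (by linarith)
  have hr2r : r₂ < r := H.lt_of_u_lt (Ioo_subset_Icc_self hr₂) (Ioo_subset_Icc_self hr)
    (by linarith)
  set I : ℝ → ℝ := fun x => lam * u x ^ (p - 1) * f (u x) * x with hI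
  have hupc : ContinuousOn (fun x => u x ^ (p - 1)) (Icc 0 1) :=
    H.u_cont.rpow_const fun x _ => Or.inr (by linarith)
  have hIc : ContinuousOn I (Icc 0 1) :=
    ((continuousOn_const.mul hupc).mul H.fu_cont).mul continuousOn_id
  have hI0 : ∀ x ∈ Icc (0:ℝ) 1, 0 ≤ I x := fun x hx =>
    mul_nonneg (mul_nonneg (mul_nonneg H.lam_pos.le (rpow_nonneg (H.u_nonneg hx) _))
      (H.f_nonneg _ (H.u_nonneg hx))) hx.1
  have hint : ∀ a b, 0 ≤ a → b ≤ 1 → MeasureTheory.IntegrableOn I (Icc a b) := fun a b ha hb =>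
    (hIc.mono (Icc_subset_Icc ha hb)).integrableOn_Icc
  have hii : ∀ a b, 0 ≤ a → a ≤ b → b ≤ 1 → IntervalIntegrable I MeasureTheory.volume a b :=
    fun a b ha hab hb => (intervalIntegrable_iff_integrableOn_Icc_of_le hab).2 (hint a b ha hb)
  have hgd : ∀ x ∈ Ioo (0:ℝ) 1, HasDerivAt (fun x => u x ^ (p - 1) * s x)
      (I x - (p - 1) * (u x ^ (p - 1) * s x) * (s x / (x * u x))) x := by
    intro x hx
    have hux := H.u_pos x ⟨hx.1.le, hx.2⟩
    refine (((H.u_deriv x hx).rpow_const (p := p - 1) (Or.inl hux.ne')).mul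
      (H.s_deriv x hx)).congr_deriv ?_
    rw [rpow_sub_one hux.ne' (p - 1), hI]
    have := hx.1.ne'
    field_simp
    ring
  have hgc : ContinuousOn (fun x => u x ^ (p - 1) * s x) (Icc 0 1) := hupc.mul H.s_cont
  have i1 := intervalIntegral.sub_le_integral_of_hasDeriv_right_of_le hr₁.1.le
    (hgc.mono (Icc_subset_Icc le_rfl hr₁.2.le))
    (fun x hx => (hgd x ⟨hx.1, hx.2.trans hr₁.2⟩).hasDerivWithinAt)
    (hint 0 r₁ le_rfl hr₁.2.le) (fun x hx => by
      have hx1 : x ∈ Ioo (0:ℝ) 1 := ⟨hx.1, hx.2.trans hr₁.2⟩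
      have hux := H.u_pos x ⟨hx.1.le, hx1.2⟩
      have hs := H.s_nonneg (Ioo_subset_Icc_self hx1)
      have : 0 ≤ (p - 1) * (u x ^ (p - 1) * s x) * (s x / (x * u x)) :=
        mul_nonneg (mul_nonneg (by linarith) (by positivity))
          (div_nonneg hs (mul_pos hx.1 hux).le)
      linarith)
  have i2 := intervalIntegral.sub_le_integral_of_hasDeriv_right_of_le hr12.le
    (g := fun x => u x ^ (p - 1) * s x - (p - 1) * c * log (u x))
    (g' := fun x => I x - (p - 1) * (u x ^ (p - 1) * s x) * (s x / (x * u x))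
      - (p - 1) * c * ((-s x / x) / u x)) (φ := I)
    (by
      refine ContinuousOn.sub (hgc.mono (Icc_subset_Icc hr₁.1.le hr₂.2.le))
        (continuousOn_const.mul ((H.u_cont.mono (Icc_subset_Icc hr₁.1.le hr₂.2.le)).log ?_))
      intro x hx
      exact (H.u_pos x ⟨hr₁.1.le.trans hx.1, hx.2.trans_lt hr₂.2⟩).ne')
    (fun x hx => by
      have hx1 : x ∈ Ioo (0:ℝ) 1 := ⟨hr₁.1.trans hx.1, hx.2.trans hr₂.2⟩
      have hux := H.u_pos x ⟨hx1.1.le, hx1.2⟩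
      exact ((hgd x hx1).sub
        (((H.u_deriv x hx1).log hux.ne').const_mul _)).hasDerivWithinAt)
    (hint r₁ r₂ hr₁.1.le hr₂.2.le) (fun x hx => by
      have hx1 : x ∈ Ioo (0:ℝ) 1 := ⟨hr₁.1.trans hx.1, hx.2.trans hr₂.2⟩
      have hxx := Ioo_subset_Icc_self hx1
      have hux := H.u_pos x ⟨hx1.1.le, hx1.2⟩
      have hs := H.s_nonneg hxx
      have hk := hμ lam u s H x hx1
        (hur₂ ▸ H.u_anti hxx (Ioo_subset_Icc_self hr₂) hx.2.le)
        (hur₁ ▸ H.u_anti (Ioo_subset_Icc_self hr₁) hxx hx.1.le)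
      have : 0 ≤ (p - 1) * (u x ^ (p - 1) * s x - c) * (s x / (x * u x)) :=
        mul_nonneg (mul_nonneg (by linarith) (by linarith))
          (div_nonneg hs (mul_pos hx1.1 hux).le)
      have e : (-s x / x) / u x = -(s x / (x * u x)) := by
        rw [neg_div, neg_div, div_div]
      rw [e]
      linarith)
  have i3 : 0 ≤ ∫ x in r₂..r, I x :=
    intervalIntegral.integral_nonneg hr2r.le fun x hx =>
      hI0 x ⟨hr₂.1.le.trans hx.1, hx.2.trans hr.2.le⟩
  have e1 : (∫ x in (0:ℝ)..r, I x) =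
      (∫ x in (0:ℝ)..r₁, I x) + (∫ x in r₁..r₂, I x) + ∫ x in r₂..r, I x := by
    rw [intervalIntegral.integral_add_adjacent_intervals
        (hii _ _ le_rfl hr₁.1.le hr₁.2.le) (hii _ _ hr₁.1.le hr12.le hr₂.2.le),
      intervalIntegral.integral_add_adjacent_intervals
        (hii _ _ le_rfl hr₂.1.le hr₂.2.le) (hii _ _ hr₂.1.le hr2r.le hr.2.le)]
  have h0 : 0 ≤ u r₂ ^ (p - 1) * s r₂ :=
    mul_nonneg (rpow_nonneg (H.u_nonneg (Ioo_subset_Icc_self hr₂)) _)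
      (H.s_nonneg (Ioo_subset_Icc_self hr₂))
  have hlog : log (u r₁) - log (u r₂) = L := by
    rw [hur₁, hur₂, mul_comm_div, log_mul (exp_pos _).ne' (by positivity), log_exp]
    ring
  have hlog' : (p - 1) * c * log (u r₁) - (p - 1) * c * log (u r₂) = (p - 1) * c * L := by
    rw [← mul_sub, hlog]
  have hKL : K ≤ (p - 1) * c * L := by
    have : (p - 1) * c * L = |K| + (p - 1) * c := by
      rw [hL, mul_add, mul_one, mul_comm _ (_ / _), div_mul_cancel₀ _ hpc.ne']
    linarith [le_abs_self K]
  simp only [H.s_zero] at i1 i2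
  rw [e1]
  linarith

theorem eventually_exp_le_lam (hp : 2 < p) (hfc : ContinuousOn f (Ici 0))
    (hg : ∀ η, 0 < η → ∃ M, ExpGrowth p η M f) {ε : ℝ} (hε : 0 < ε) : ∀ᶠ μ : ℝ in atTop, ∀ (lam : ℝ) (u s : ℝ → ℝ),
      RadialProfile f lam μ u s → exp (-(ε * μ ^ p)) ≤ lam := by
  have hp0 : 0 < p := by linarith
  have hε1 : 0 < (ε / 4) ^ (1 / p) := by positivity
  obtain ⟨η, hη0, hη, hη6, hηε⟩ := exists_small_parameter hp ((ε / 4) ^ (1 / p))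
    (e := ε / 6) (by positivity)
  obtain ⟨M, g⟩ := hg η hη0
  have t2 : ∀ᶠ μ : ℝ in atTop, 1 ≤ 4 * (η / p * μ) :=
    ((tendsto_id.const_mul_atTop (by positivity)).const_mul_atTop (by norm_num)
      ).eventually_ge_atTop 1
  obtain ⟨C, hC'⟩ := (isCompact_Icc (a := 0) (b := M)).bddAbove_image
    (hfc.mono Icc_subset_Ici_self)
  have hC : ∀ t ∈ Icc 0 M, f t ≤ C := fun t ht => hC' ⟨t, ht, rfl⟩
  have t3 := (tendsto_exp_atTop.comp
    (tendsto_rpow_mul_atTop (η := ε / 2) hp0 (by positivity))).eventually_gt_atTop C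
  filter_upwards [t2, t3, eventually_exp_small hp0 hη0, eventually_ge_atTop (2 * M)]
    with μ h2 h3 h4 h5 lam u s H
  by_contra! hlam
  have hμ0 := H.μ_pos
  have hlam0 := H.lam_pos
  have hm0 : 0 < μ ^ p := by positivity
  obtain ⟨b, hb0, hb1, hWb, hlast⟩ := H.exists_last_bubble g hp.le hη0 hη (by linarith) h2
    (R := 1) ⟨zero_lt_one, le_rfl⟩ (by rw [H.u_one]; positivity)
  have hub0 := H.u_nonneg ⟨hb0.le, hb1⟩
  have hfb : exp (ε / 2 * μ ^ p) ≤ f (u b) := by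
    have h6 : lam * b ^ 2 * f (u b) ≤ exp (-(ε * μ ^ p)) * f (u b) := by
      refine mul_le_mul_of_nonneg_right ?_ (H.f_nonneg _ hub0)
      have : b ^ 2 ≤ 1 := by nlinarith
      nlinarith
    have h7 := hWb.trans h6
    rw [exp_neg (ε * μ ^ p), inv_mul_eq_div, le_div_iff₀ (exp_pos _), ← exp_add] at h7
    refine le_trans (exp_le_exp.2 ?_) h7
    nlinarith
  have hM : M ≤ u b := by
    by_contra! hlt
    exact absurd (hC _ ⟨hub0, hlt.le⟩) (not_le.2 (h3.trans_le hfb))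
  have hub : (ε / 4) ^ (1 / p) * μ ≤ u b := by
    have h6 := exp_le_exp.1 (hfb.trans (g.upper _ hM))
    by_contra! hlt
    have h7 := rpow_lt_rpow hub0 hlt hp0
    rw [mul_rpow hε1.le hμ0.le, ← rpow_mul (by positivity), one_div_mul_cancel hp0.ne',
      rpow_one] at h7
    have : 0 ≤ u b ^ p := rpow_nonneg hub0 _
    nlinarith
  have hlam1 : lam * 1 ^ 2 ≤ exp (η * μ ^ p) := by
    rw [one_pow, mul_one]
    refine hlam.le.trans (exp_le_exp.2 ?_)
    have : 0 ≤ ε * μ ^ p := by positivity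
    have : 0 ≤ η * μ ^ p := by positivity
    linarith
  have := H.proportion_le g hp.le hη0 hη hε1 hηε h4 hb0 hb1 le_rfl hlam1 hWb hM hub hlast
  rw [H.u_one] at this
  have h8 : 0 < (1 - 2 / p) / 2 := by
    have : 2 / p < 1 := by rwa [div_lt_one hp0]
    linarith
  have h9 : 0 < u b := by linarith [g.one_le]
  nlinarith

theorem eventually_lam_le_exp (hp : 2 < p) (hg : ∀ η, 0 < η → ∃ M, ExpGrowth p η M f)
    {ε : ℝ} (hε : 0 < ε) : ∀ᶠ μ : ℝ in atTop, ∀ (lam : ℝ) (u s : ℝ → ℝ),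
      RadialProfile f lam μ u s → lam ≤ exp (ε * μ ^ p) := by
  have hp0 : 0 < p := by linarith
  obtain ⟨c, hc, hcε⟩ := exists_le_rpow_mul_s hp hg
  obtain ⟨e, he0, he4, hec⟩ : ∃ e : ℝ, 0 < e ∧ e ≤ 1 / 4 ∧ 2 * e ^ p ≤ ε / 2 * c := by
    have hcont : ContinuousAt (fun e : ℝ => 2 * e ^ p) 0 :=
      continuousAt_const.mul (continuousAt_rpow_const _ _ (Or.inr hp0.le))
    have hlt : (fun e : ℝ => 2 * e ^ p) 0 < ε / 2 * c := by
      simp only [zero_rpow hp0.ne', mul_zero]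
      positivity
    obtain ⟨e, h3, h2, h1⟩ := exists_pos_lt_of_continuousAt hcont hlt (e := 1 / 4) (by norm_num)
    exact ⟨e, h3, h2.le, h1.le⟩
  set η := min (ε / 2) (1 / 2) with hη
  have hη0 : 0 < η := by positivity
  obtain ⟨M, g⟩ := hg η hη0
  have t1 : ∀ᶠ μ : ℝ in atTop, M ≤ e * μ :=
    (tendsto_id.const_mul_atTop he0).eventually_ge_atTop M
  have t3 := (tendsto_rpow_mul_atTop hp0 hη0).eventually_ge_atTop (log 8)
  filter_upwards [t1, t3, hcε e he0] with μ h1 h3 hμ lam u s H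
  have h8 : 8 ≤ exp (η * μ ^ p) := (log_le_iff_le_exp (by norm_num)).1 h3
  have hμ0 := H.μ_pos
  have hlam0 := H.lam_pos
  obtain ⟨r, hr, hur⟩ := H.exists_level (y := e * μ) (by positivity) (by nlinarith)
  have hs := hμ lam u s H r hr hur.ge (by rw [hur]; nlinarith)
  have hl := H.lam_mul_sq_le g hp.le (min_le_right _ _) h8 hr (h1.trans hur.ge)
  have hd := H.s_mul_log_le hr.1 hr.2.le le_rfl
  have hu0 : 0 < u r := by rw [hur]; positivity
  rw [H.u_one, sub_zero, one_div, log_inv] at hd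
  have hA : u r ^ (p - 1) * u r = e ^ p * μ ^ p := by
    rw [← rpow_add_one hu0.ne', sub_add_cancel, hur, mul_rpow he0.le hμ0.le]
  have hlogr : 0 ≤ -log r := by linarith [log_nonpos hr.1.le hr.2.le]
  have h9 : c * -log r ≤ e ^ p * μ ^ p := by
    rw [← hA]
    calc c * -log r ≤ u r ^ (p - 1) * s r * -log r := mul_le_mul_of_nonneg_right hs hlogr
      _ = u r ^ (p - 1) * (s r * -log r) := by ring
      _ ≤ _ := mul_le_mul_of_nonneg_left hd (rpow_nonneg hu0.le _)
  have h10 : 2 * -log r ≤ ε / 2 * μ ^ p := by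
    have h11 : 2 * e ^ p * μ ^ p ≤ ε / 2 * c * μ ^ p :=
      mul_le_mul_of_nonneg_right hec (by positivity)
    have : (2 * -log r) * c ≤ (ε / 2 * μ ^ p) * c := by linarith
    exact le_of_mul_le_mul_right this hc
  have h12 := log_le_log (mul_pos hlam0 (pow_pos hr.1 2)) hl
  rw [log_exp, log_mul hlam0.ne' (pow_pos hr.1 2).ne', log_pow] at h12
  push_cast at h12
  rw [← log_le_iff_le_exp hlam0]
  have h13 : η * μ ^ p ≤ ε / 2 * μ ^ p :=
    mul_le_mul_of_nonneg_right (min_le_left _ _) (by positivity)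
  linarith

end Quantitative

theorem exists_expGrowth {p : ℝ} (hp : 1 ≤ p) {h : ℝ → ℝ}
    (hd : ∀ x, 0 < x → DifferentiableAt ℝ h x) {t₀ : ℝ} (hpos : ∀ t, t₀ ≤ t → 0 < h t)
    (H1 : Tendsto (fun t : ℝ => deriv h t / (t ^ (p - 1) * h t)) atTop (𝓝 0))
    {η : ℝ} (hη : 0 < η) : ∃ M, ExpGrowth p η M (fun t => h t * exp (t ^ p)) := by
  have hp0 : 0 < p := by linarith
  have hδ : |0| < p * η / 2 := by
    rw [abs_zero]
    positivity
  have hev := (H1.abs.eventually_le_const hδ).and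
    ((eventually_ge_atTop 1).and (eventually_ge_atTop t₀))
  obtain ⟨M₁, hM₁⟩ := hev.exists_forall_of_atTop
  have hM1 : 1 ≤ M₁ := (hM₁ M₁ le_rfl).2.1
  have hh : ∀ x, M₁ ≤ x → 0 < h x := fun x hx => hpos x (hM₁ x hx).2.2
  have hx0 : ∀ x, M₁ ≤ x → 0 < x := fun x hx => by linarith
  have hq : ∀ x, M₁ ≤ x → |deriv h x / h x| ≤ p * η / 2 * x ^ (p - 1) := by
    intro x hx
    have h1 := (hM₁ x hx).1
    have h2 : 0 < x ^ (p - 1) := rpow_pos_of_pos (hx0 x hx) _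
    rw [mul_comm (x ^ (p - 1)), ← div_div, abs_div, abs_of_pos h2, div_le_iff₀ h2] at h1
    exact h1
  have hlogd : ∀ x, M₁ ≤ x → HasDerivAt (fun x => log (h x)) (deriv h x / h x) x :=
    fun x hx => (hd x (hx0 x hx)).hasDerivAt.log (hh x hx).ne'
  have hpowd : ∀ x, HasDerivAt (fun x : ℝ => η / 2 * x ^ p) (p * η / 2 * x ^ (p - 1)) x :=
    fun x => ((Real.hasDerivAt_rpow_const (Or.inr hp)).const_mul (η / 2)).congr_deriv (by ring)
  have hm1 : MonotoneOn (fun x => η / 2 * x ^ p - log (h x)) (Ici M₁) := by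
    apply monotoneOn_of_hasDerivWithinAt_nonneg
      (f' := fun x => p * η / 2 * x ^ (p - 1) - deriv h x / h x) (convex_Ici M₁)
    · exact fun x hx => ((hpowd x).sub (hlogd x hx)).continuousAt.continuousWithinAt
    · exact fun x hx => ((hpowd x).sub (hlogd x (interior_subset hx))).hasDerivWithinAt
    · intro x hx
      linarith [(abs_le.1 (hq x (interior_subset hx))).2]
  have hm2 : MonotoneOn (fun x => η / 2 * x ^ p + log (h x)) (Ici M₁) := by
    apply monotoneOn_of_hasDerivWithinAt_nonneg
      (f' := fun x => p * η / 2 * x ^ (p - 1) + deriv h x / h x) (convex_Ici M₁)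
    · exact fun x hx => ((hpowd x).add (hlogd x hx)).continuousAt.continuousWithinAt
    · exact fun x hx => ((hpowd x).add (hlogd x (interior_subset hx))).hasDerivWithinAt
    · intro x hx
      linarith [(abs_le.1 (hq x (interior_subset hx))).1]
  have hC : Tendsto (fun x : ℝ => η / 2 * x ^ p) atTop atTop :=
    (tendsto_rpow_atTop hp0).const_mul_atTop (by positivity)
  obtain ⟨M₂, hM₂⟩ := (hC.eventually_ge_atTop
    (η / 2 * M₁ ^ p + |log (h M₁)|)).exists_forall_of_atTop
  have hlog : ∀ x, max M₁ M₂ ≤ x → |log (h x)| ≤ η * x ^ p := by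
    intro x hx
    have hx1 : M₁ ≤ x := (le_max_left _ _).trans hx
    have h1 := hm1 self_mem_Ici hx1 hx1
    have h2 := hm2 self_mem_Ici hx1 hx1
    have h3 := hM₂ x ((le_max_right _ _).trans hx)
    simp only at h1 h2
    have h4 : 0 ≤ η / 2 * M₁ ^ p := by
      have := hx0 M₁ le_rfl
      positivity
    rw [abs_le]
    constructor <;> linarith [le_abs_self (log (h M₁)), neg_abs_le (log (h M₁))]
  refine ⟨max M₁ M₂, hM1.trans (le_max_left _ _), fun x hx => ?_, fun x hx => ?_, fun x hx => ?_,
    fun x hx => ?_⟩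
  all_goals have hx1 : M₁ ≤ x := (le_max_left _ _).trans hx
  · exact mul_pos (hh x hx1) (exp_pos _)
  · refine ⟨deriv h x / h x + p * x ^ (p - 1), ?_, ?_⟩
    · refine ((hd x (hx0 x hx1)).hasDerivAt.mul
        (Real.hasDerivAt_rpow_const (Or.inr hp)).exp).congr_deriv ?_
      have := (hh x hx1).ne'
      field_simp
    · have h1 := (abs_le.1 (hq x hx1)).1
      have : 0 ≤ p * η / 2 * x ^ (p - 1) := by
        have := hx0 x hx1
        positivity
      linarith
  · nth_rewrite 1 [← exp_log (hh x hx1)]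
    rw [← exp_add, exp_le_exp]
    linarith [(abs_le.1 (hlog x hx)).1]
  · nth_rewrite 1 [← exp_log (hh x hx1)]
    rw [← exp_add, exp_le_exp]
    linarith [(abs_le.1 (hlog x hx)).2]

theorem tendsto_log_div_rpow {p : ℝ} {f : ℝ → ℝ}
    (hg : ∀ η, 0 < η → ∃ M, ExpGrowth p η M f) :
    Tendsto (fun x => log (f x) / x ^ p) atTop (𝓝 1) := by
  rw [Metric.tendsto_nhds]
  intro ε hε
  obtain ⟨M, g⟩ := hg (ε / 2) (by positivity)
  filter_upwards [eventually_ge_atTop M] with x hx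
  have hx0 : 0 < x ^ p := rpow_pos_of_pos (by linarith [g.one_le]) _
  have h1 := log_le_log (exp_pos _) (g.lower x hx)
  have h2 := log_le_log (g.pos x hx) (g.upper x hx)
  rw [log_exp] at h1 h2
  rw [← le_div_iff₀ hx0] at h1
  rw [← div_le_iff₀ hx0] at h2
  rw [Real.dist_eq, abs_lt]
  constructor <;> linarith

/-- A classical solution of the radial equation is a radial profile. -/
theorem exists_radialProfile {f : ℝ → ℝ} (hf0 : ∀ t, 0 ≤ t → 0 ≤ f t)
    (hfc : ContinuousOn f (Ici 0)) {lam μ : ℝ} {u : ℝ → ℝ} (hlam : 0 < lam)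
    (hu : ContDiffOn ℝ 2 u (Icc 0 1)) (hupos : ∀ r ∈ Ico (0:ℝ) 1, 0 < u r) (hu0 : u 0 = μ)
    (hu1 : u 1 = 0)
    (heq : ∀ r ∈ Ioo (0:ℝ) 1, -(deriv (deriv u) r) - deriv u r / r = lam * f (u r)) :
    ∃ s, RadialProfile f lam μ u s ∧
      ∀ r ∈ Icc (0:ℝ) 1, s r = ∫ x in (0:ℝ)..r, lam * f (u x) * x := by
  have hunn : ∀ r ∈ Icc (0:ℝ) 1, 0 ≤ u r := by
    intro r hr
    rcases eq_or_lt_of_le hr.2 with h | h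
    · rw [h, hu1]
    · exact (hupos r ⟨hr.1, h⟩).le
  have hkc : ContinuousOn (fun x => lam * f (u x) * x) (Icc 0 1) :=
    (continuousOn_const.mul (hfc.comp hu.continuousOn hunn)).mul continuousOn_id
  set k : ℝ → ℝ := fun x => lam * f (u x) * x with hk
  set k' : ℝ → ℝ := fun x => k (max 0 (min 1 x)) with hk'
  have hk'c : Continuous k' :=
    hkc.comp_continuous (by fun_prop) fun x =>
      ⟨le_max_left _ _, max_le zero_le_one (min_le_left _ _)⟩
  have hkk : ∀ x ∈ Icc (0:ℝ) 1, k' x = k x := fun x hx => by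
    simp only [hk', min_eq_right hx.2, max_eq_right hx.1]
  set s : ℝ → ℝ := fun r => ∫ x in (0:ℝ)..r, k' x with hs
  have hsd : ∀ r, HasDerivAt s (k' r) r := fun r =>
    (hk'c.integral_hasStrictDerivAt 0 r).hasDerivAt
  have hsc : Continuous s := continuous_iff_continuousAt.2 fun r => (hsd r).continuousAt
  have hs0 : s 0 = 0 := intervalIntegral.integral_same
  set v := derivWithin u (Icc 0 1) with hv
  have hvc : ContinuousOn v (Icc 0 1) :=
    hu.continuousOn_derivWithin (uniqueDiffOn_Icc zero_lt_one) (by norm_num)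
  have hvd : ∀ r ∈ Ioo (0:ℝ) 1, v r = deriv u r := fun r hr =>
    derivWithin_of_mem_nhds (Icc_mem_nhds hr.1 hr.2)
  have hud : ∀ r ∈ Ioo (0:ℝ) 1, HasDerivAt u (deriv u r) r := fun r hr =>
    ((hu.differentiableOn (by norm_num)).differentiableAt
      (Icc_mem_nhds hr.1 hr.2)).hasDerivAt
  have hudd : ∀ r ∈ Ioo (0:ℝ) 1, HasDerivAt (deriv u) (deriv (deriv u) r) r := by
    intro r hr
    have h1 : ContDiffOn ℝ (1 + 1) u (Ioo 0 1) := by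
      rw [one_add_one_eq_two]
      exact hu.mono Ioo_subset_Icc_self
    have h2 := ((contDiffOn_succ_iff_deriv_of_isOpen isOpen_Ioo).1 h1).2.2
    exact ((h2.differentiableOn (by norm_num)).differentiableAt
      (isOpen_Ioo.mem_nhds hr)).hasDerivAt
  have hwc : ContinuousOn (fun r => r * v r + s r) (Icc 0 1) :=
    (continuousOn_id.mul hvc).add hsc.continuousOn
  have hwd : ∀ r ∈ Ioo (0:ℝ) 1, HasDerivAt (fun r => r * v r + s r) 0 r := by
    intro r hr
    have h1 : HasDerivAt v (deriv (deriv u) r) r := by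
      refine (hudd r hr).congr_of_eventuallyEq ?_
      filter_upwards [isOpen_Ioo.mem_nhds hr] with x hx using hvd x hx
    refine (((hasDerivAt_id r).mul h1).add (hsd r)).congr_deriv ?_
    have h2 := heq r hr
    have hr0 := hr.1.ne'
    rw [hkk r (Ioo_subset_Icc_self hr), hvd r hr]
    simp only [hk, id, ← h2]
    field_simp
    ring
  have hw : ∀ r ∈ Icc (0:ℝ) 1, r * v r + s r = 0 := by
    intro r hr
    have h1 := monotoneOn_Icc_of_hasDerivAt hwc hwd (fun _ _ => le_rfl)
      ⟨le_rfl, zero_le_one⟩ hr hr.1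
    have h2 := monotoneOn_Icc_of_hasDerivAt hwc.neg (fun r hr => (hwd r hr).neg)
      (fun _ _ => by simp) ⟨le_rfl, zero_le_one⟩ hr hr.1
    simp only [Pi.neg_apply, hs0] at h1 h2
    linarith
  refine ⟨s, ⟨hlam, hf0, hfc, hu.continuousOn, hsc.continuousOn, hu0, hu1, hs0, hupos, ?_, ?_⟩, ?_⟩
  · intro r hr
    refine (hud r hr).congr_deriv ?_
    rw [eq_div_iff hr.1.ne', ← hvd r hr]
    linarith [hw r (Ioo_subset_Icc_self hr)]
  · intro r hr
    refine (hsd r).congr_deriv ?_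
    rw [hkk r (Ioo_subset_Icc_self hr), hk]
    ring
  · intro r hr
    refine intervalIntegral.integral_congr fun x hx => hkk x ?_
    rw [uIcc_of_le hr.1] at hx
    exact ⟨hx.1, hx.2.trans hr.2⟩

theorem IsBubbleSeq.pos {p : ℝ} {a δ : ℕ → ℝ} (hb : IsBubbleSeq p a δ) (k : ℕ) :
    0 < a k ∧ 0 < δ k := by
  obtain ⟨ha, hδ, hk⟩ := hb
  cases k with
  | zero => rw [ha, hδ]; norm_num
  | succ k => exact ⟨(hk k).2.2.2.1, (hk k).1.1⟩

/-- Theorem 1.5 of the paper, unbounded energy in the supercritical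
case `p > 2`. -/
theorem statement13
    (p : ℝ) (hp : 2 < p)
    (h : ℝ → ℝ)
    (hhC1 : ContDiffOn ℝ 1 h (Set.Ici 0))
    (hhnonneg : ∀ t : ℝ, 0 ≤ t → 0 ≤ h t)
    (t₀ : ℝ) (ht₀ : 0 < t₀) (hhpos : ∀ t : ℝ, t₀ ≤ t → 0 < h t)
    (f : ℝ → ℝ) (hf : ∀ t : ℝ, f t = h t * Real.exp (t ^ p))
    (H1 : Tendsto (fun t : ℝ => deriv h t / (t ^ (p - 1) * h t)) atTop (nhds 0))
    (lam μ : ℕ → ℝ) (u : ℕ → ℝ → ℝ)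
    (hlam : ∀ n, 0 < lam n) (hμ : ∀ n, 0 < μ n)
    (huC2 : ∀ n, ContDiffOn ℝ 2 (u n) (Set.Icc 0 1))
    (hupos : ∀ n, ∀ r ∈ Set.Ico (0:ℝ) 1, 0 < u n r)
    (hu0 : ∀ n, u n 0 = μ n)
    (hu'0 : ∀ n, deriv (u n) 0 = 0)
    (hu1 : ∀ n, u n 1 = 0)
    (heq : ∀ n, ∀ r ∈ Set.Ioo (0:ℝ) 1,
      -(deriv (deriv (u n)) r) - deriv (u n) r / r = lam n * f (u n r))
    (hmuInf : Tendsto μ atTop atTop)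
    (a δ : ℕ → ℝ) (hb : IsBubbleSeq p a δ) :
    ∀ r : ℕ → ℝ, (∀ n, r n ∈ Set.Ioo (0:ℝ) 1) →
      Tendsto (fun n => u n (r n) / μ n) atTop (nhds 0) →
      ∃ φ : ℕ → ℕ, StrictMono φ ∧
        -- (1) divergence of the (modified) energy
        Tendsto (fun n =>
            p * ∫ x in (0:ℝ)..(r (φ n)),
              lam (φ n) * (u (φ n) x) ^ (p - 1) * f (u (φ n) x) * x)
          atTop atTop ∧
        -- (2)
        Tendsto (fun n =>
            p * μ (φ n) ^ (p - 1) *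
              ∫ x in (0:ℝ)..(r (φ n)), lam (φ n) * f (u (φ n) x) * x)
          atTop atTop ∧
        -- (3) asymptotics of λ_n
        Tendsto (fun n => Real.log (1 / lam (φ n)) / μ (φ n) ^ p)
          atTop (nhds 0) ∧
        -- (4) location of the k-th concentration center
        (∀ (k : ℕ) (rk : ℕ → ℝ),
          (∀ n, rk n ∈ Set.Ioo (0:ℝ) 1) →
          Tendsto (fun n => u (φ n) (rk n) / μ (φ n)) atTop (nhds (δ k)) →
          Tendsto (fun n =>
              p * lam (φ n) * (rk n) ^ 2 * (u (φ n) (rk n)) ^ (p - 1) *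
                f (u (φ n) (rk n)))
            atTop (nhds ((a k) ^ 2 / 2)) →
          Tendsto (fun n => Real.log (1 / rk n) / μ (φ n) ^ p)
            atTop (nhds (δ k ^ p / 2))) ∧
        -- (5) entire blow-up of p μ^{p-1} u_n
        (∀ s : ℝ, s ∈ Set.Ico (0:ℝ) 1 →
          Tendsto (fun n => p * μ (φ n) ^ (p - 1) * u (φ n) s) atTop atTop) := by
  have hp0 : 0 < p := by linarith
  have hff : f = fun t => h t * exp (t ^ p) := funext hf
  have hg : ∀ η, 0 < η → ∃ M, ExpGrowth p η M f := fun η hη => by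
    rw [hff]
    exact exists_expGrowth (by linarith) (fun x hx =>
      (hhC1.differentiableOn (by norm_num)).differentiableAt (Ici_mem_nhds hx)) hhpos H1 hη
  have hf0 : ∀ t, 0 ≤ t → 0 ≤ f t := fun t ht => by
    rw [hf]
    exact mul_nonneg (hhnonneg t ht) (exp_pos _).le
  have hfc : ContinuousOn f (Ici 0) := by
    rw [hff]
    exact hhC1.continuousOn.mul
      (continuousOn_id.rpow_const fun x _ => Or.inr hp0.le).rexp
  choose s hs hsint using fun n => exists_radialProfile hf0 hfc (hlam n) (huC2 n) (hupos n)
    (hu0 n) (hu1 n) (heq n)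
  have hm : Tendsto (fun n => μ n ^ p) atTop atTop := (tendsto_rpow_atTop hp0).comp hmuInf
  have hlog : Tendsto (fun n => log (1 / lam n) / μ n ^ p) atTop (𝓝 0) := by
    rw [Metric.tendsto_nhds]
    intro ε hε
    filter_upwards [hmuInf.eventually (eventually_exp_le_lam hp hfc hg (half_pos hε)),
      hmuInf.eventually (eventually_lam_le_exp hp hg (half_pos hε))] with n h1 h2
    have h1 := log_le_log (exp_pos _) (h1 _ _ _ (hs n))
    have h2 := log_le_log (hlam n) (h2 _ _ _ (hs n))
    have hμp : 0 < μ n ^ p := rpow_pos_of_pos (hμ n) _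
    rw [log_exp] at h1 h2
    have h3 : 0 < ε / 2 * μ n ^ p := by positivity
    rw [Real.dist_eq, sub_zero, abs_div, abs_of_pos hμp, div_lt_iff₀ hμp, one_div, log_inv, abs_lt]
    constructor <;> linarith
  intro r hr hru
  have hsmall : ∀ ε, 0 < ε → ∀ᶠ n in atTop, u n (r n) < ε * μ n := fun ε hε => by
    filter_upwards [hru.eventually_lt_const hε] with n hn
    rwa [div_lt_iff₀ (hμ n)] at hn
  refine ⟨id, strictMono_id, ?_, ?_, hlog, ?_, ?_⟩
  · refine tendsto_atTop.2 fun K => ?_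
    obtain ⟨ε, hε, hK⟩ := exists_le_energy hp hg (K / p)
    filter_upwards [hmuInf.eventually hK, hsmall ε hε] with n h1 h2
    have := h1 _ _ _ (hs n) (r n) (hr n) h2
    rwa [div_le_iff₀' hp0] at this
  · refine tendsto_atTop.2 fun K => ?_
    obtain ⟨ε, hε, hK⟩ := exists_le_mul_s hp hg (K / p)
    filter_upwards [hmuInf.eventually hK, hsmall ε hε] with n h1 h2
    have := h1 _ _ _ (hs n) (r n) (hr n) h2
    rwa [div_le_iff₀' hp0, hsint n _ (Ioo_subset_Icc_self (hr n)), ← mul_assoc] at this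
  · intro k rk hrk hδk hak
    obtain ⟨ha, hδ⟩ := hb.pos k
    simp only [id] at hδk hak ⊢
    have hU : Tendsto (fun n => u n (rk n)) atTop atTop := by
      refine (hδk.pos_mul_atTop hδ hmuInf).congr fun n => ?_
      exact div_mul_cancel₀ _ (hμ n).ne'
    have hUp := hδk.rpow_const (p := p) (Or.inr hp0.le)
    obtain ⟨M, g⟩ := hg 1 one_pos
    have l1 := ((tendsto_log_div_rpow hg).comp hU).mul hUp
    have l2 := (((isLittleO_log_rpow_atTop hp0).tendsto_div_nhds_zero.comp hU).mul hUp).const_mul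
      (p - 1)
    have l3 := (hak.log (by positivity)).div_atTop hm
    have l4 := (tendsto_const_nhds (x := log p)).div_atTop hm
    have l5 := ((((l4.sub hlog).add l2).add l1).sub l3).div_const 2
    simp only [sub_zero, zero_mul, mul_zero, one_mul, zero_add] at l5
    refine l5.congr' ?_
    filter_upwards [hU.eventually_ge_atTop M] with n hn
    have hUn : 0 < u n (rk n) := by linarith [g.one_le]
    have hfU := g.pos _ hn
    have hr0 := (hrk n).1
    have hl := hlam n
    have hμn := hμ n
    simp only [Function.comp]
    rw [div_rpow hUn.le hμn.le, log_mul (by positivity) hfU.ne',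
      log_mul (by positivity) (by positivity), log_mul (by positivity) (by positivity),
      log_mul (by positivity) (by positivity), log_rpow hUn, log_pow, one_div, one_div, log_inv,
      log_inv]
    have : 0 < u n (rk n) ^ p := by positivity
    have : 0 < μ n ^ p := by positivity
    field_simp
    push_cast
    ring
  · intro x hx
    refine tendsto_atTop.2 fun K => ?_
    simp only [id]
    have hmain : ∀ᶠ n in atTop, |K| ≤ μ n ^ (p - 1) * u n x := by
      rcases hx.1.eq_or_lt with h0 | h0
      · filter_upwards [hmuInf.eventually_ge_atTop 1, hmuInf.eventually_ge_atTop |K|] with n h1 h2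
        rw [← h0, hu0]
        nlinarith [one_le_rpow h1 (by linarith : 0 ≤ p - 1)]
      · have hl : 0 < log (1 / x) := log_pos (by rw [lt_div_iff₀ h0]; linarith [hx.2])
        obtain ⟨ε, hε, hK⟩ := exists_le_mul_s hp hg (|K| / log (1 / x))
        filter_upwards [hmuInf.eventually hK, hmuInf.eventually_ge_atTop 1,
          (hmuInf.const_mul_atTop hε).eventually_ge_atTop |K|] with n h1 h2 h3
        have h4 : 1 ≤ μ n ^ (p - 1) := one_le_rpow h2 (by linarith)
        rcases lt_or_ge (u n x) (ε * μ n) with h5 | h5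
        · have h6 := h1 _ _ _ (hs n) x ⟨h0, hx.2⟩ h5
          have h7 := (hs n).s_mul_log_le h0 hx.2.le le_rfl
          rw [hu1, sub_zero] at h7
          rw [div_le_iff₀ hl, mul_assoc] at h6
          exact h6.trans (mul_le_mul_of_nonneg_left h7 (by linarith))
        · nlinarith [abs_nonneg K]
    filter_upwards [hmain] with n hn
    rw [mul_assoc]
    nlinarith [le_abs_self K, abs_nonneg K]
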